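/- Suppose P_X = ∏_{i=1}^d P_{X_i} is a product measure on ℝ^d and the channel factorizes coordinatewise, i.e., Y = (Y_1, …, Y_d) and P_{Y|X}(·|x) = ∏_{i=1}^d P_{Y_i|X_i}(·|x_i) for Markov kernels P_{Y_i|X_i}. Then for every integer M ≥ 2, the Ziv–Zakai bound tensorizes: ZZ̄(P_X, P_{Y|X}, M) = ∑_{i=1}^d ZZ̄(P_{X_i}, P_{Y_i|X_i}, M) and ZZ(P_X, P_{Y|X}, M) = ∑_{i=1}^d ZZ(P_{X_i}, P_{Y_i|X_i}, M), where the scalar bounds on the right-hand sides are the d = 1 instances of the same definitions. -/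

import Mathlib

open MeasureTheory ProbabilityTheory ENNReal

noncomputable section

variable {d : ℕ} {𝒴 : Type*} [MeasurableSpace 𝒴]

/-- Law of `X - u` when `X ∼ P`. -/
def shiftLaw (P : Measure (Fin d → ℝ)) (u : Fin d → ℝ) : Measure (Fin d → ℝ) :=
  P.map (· - u)

/-- The mixture measure `μ_U = ∑_k P_{X-u_k}`. -/
def mixMeasure (P : Measure (Fin d → ℝ)) {M : ℕ} (U : Fin M → Fin d → ℝ) :
    Measure (Fin d → ℝ) :=
  ∑ k : Fin M, shiftLaw P (U k)

/-- The prior `p_i(x) = dP_{X-u_i}/dμ_U (x)`. -/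
def prior (P : Measure (Fin d → ℝ)) {M : ℕ} (U : Fin M → Fin d → ℝ) (i : Fin M)
    (x : Fin d → ℝ) : ℝ≥0∞ :=
  (shiftLaw P (U i)).rnDeriv (mixMeasure P U) x

/-- Minimum Bayes error probability of the `M`-ary hypothesis test where hypothesis `i`
has prior `p_i(x)` and observation law `κ(·|x+u_i)`. -/
def bayesError (P : Measure (Fin d → ℝ)) (κ : Kernel (Fin d → ℝ) 𝒴) {M : ℕ}
    (U : Fin M → Fin d → ℝ) (x : Fin d → ℝ) : ℝ≥0∞ :=
  ⨅ (φ : 𝒴 → Fin M) (_ : Measurable φ),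
    ∑ i : Fin M, prior P U i x * κ (x + U i) {y | φ y ≠ i}

/-- `h(t,i,M)`. -/
def hFun (P : Measure (Fin d → ℝ)) (κ : Kernel (Fin d → ℝ) 𝒴) (M : ℕ) (t : ℝ)
    (i : Fin d) : ℝ≥0∞ :=
  ⨆ (U : Fin M → Fin d → ℝ) (_ : ∀ k : Fin M, U k i = (k : ℝ) * t),
    ∫⁻ x, bayesError P κ U x ∂(mixMeasure P U)

/-- Ziv-Zakai bound without valley-filling. -/
def ZZ (P : Measure (Fin d → ℝ)) (κ : Kernel (Fin d → ℝ) 𝒴) (M : ℕ) : ℝ≥0∞ :=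
  ∑ i : Fin d, ∫⁻ t in Set.Ioi (0 : ℝ),
    ENNReal.ofReal (t / 2) * (hFun P κ M t i / ((M : ℝ≥0∞) - 1))

/-- Ziv-Zakai bound with valley-filling. -/
def ZZbar (P : Measure (Fin d → ℝ)) (κ : Kernel (Fin d → ℝ) 𝒴) (M : ℕ) : ℝ≥0∞ :=
  ∑ i : Fin d, ∫⁻ t in Set.Ioi (0 : ℝ),
    ENNReal.ofReal (t / 2) * ⨆ (u : ℝ) (_ : t ≤ u), hFun P κ M u i / ((M : ℝ≥0∞) - 1)


/-! Scalar (`d = 1`) instances of the same definitions, for a real-valued estimand. -/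

/-- Law of `X - u` when `X ∼ P`, scalar case. -/
def shiftLaw1 (P : Measure ℝ) (u : ℝ) : Measure ℝ :=
  P.map (· - u)

/-- The mixture measure `μ_U = ∑_k P_{X-u_k}`, scalar case. -/
def mixMeasure1 (P : Measure ℝ) {M : ℕ} (U : Fin M → ℝ) : Measure ℝ :=
  ∑ k : Fin M, shiftLaw1 P (U k)

/-- The prior `p_i(x)`, scalar case. -/
def prior1 (P : Measure ℝ) {M : ℕ} (U : Fin M → ℝ) (i : Fin M) (x : ℝ) : ℝ≥0∞ :=
  (shiftLaw1 P (U i)).rnDeriv (mixMeasure1 P U) x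

/-- Minimum Bayes error probability, scalar case. -/
def bayesError1 (P : Measure ℝ) (κ : Kernel ℝ 𝒴) {M : ℕ} (U : Fin M → ℝ) (x : ℝ) :
    ℝ≥0∞ :=
  ⨅ (φ : 𝒴 → Fin M) (_ : Measurable φ),
    ∑ i : Fin M, prior1 P U i x * κ (x + U i) {y | φ y ≠ i}

/-- `h(t,M)`, scalar case (the constraint forces `u_k = kt`). -/
def hFun1 (P : Measure ℝ) (κ : Kernel ℝ 𝒴) (M : ℕ) (t : ℝ) : ℝ≥0∞ :=
  ⨆ (U : Fin M → ℝ) (_ : ∀ k : Fin M, U k = (k : ℝ) * t),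
    ∫⁻ x, bayesError1 P κ U x ∂(mixMeasure1 P U)

/-- Ziv-Zakai bound without valley-filling, scalar case. -/
def ZZ1 (P : Measure ℝ) (κ : Kernel ℝ 𝒴) (M : ℕ) : ℝ≥0∞ :=
  ∫⁻ t in Set.Ioi (0 : ℝ),
    ENNReal.ofReal (t / 2) * (hFun1 P κ M t / ((M : ℝ≥0∞) - 1))

/-- Ziv-Zakai bound with valley-filling, scalar case. -/
def ZZbar1 (P : Measure ℝ) (κ : Kernel ℝ 𝒴) (M : ℕ) : ℝ≥0∞ :=
  ∫⁻ t in Set.Ioi (0 : ℝ),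
    ENNReal.ofReal (t / 2) * ⨆ (u : ℝ) (_ : t ≤ u), hFun1 P κ M u / ((M : ℝ≥0∞) - 1)

instance isFiniteMeasure_shiftLaw (P : Measure (Fin d → ℝ)) [IsFiniteMeasure P]
    (u : Fin d → ℝ) : IsFiniteMeasure (shiftLaw P u) :=
  inferInstanceAs (IsFiniteMeasure (P.map (· - u)))

instance isFiniteMeasure_shiftLaw1 (P : Measure ℝ) [IsFiniteMeasure P] (u : ℝ) :
    IsFiniteMeasure (shiftLaw1 P u) :=
  inferInstanceAs (IsFiniteMeasure (P.map (· - u)))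

instance isFiniteMeasure_mixMeasure (P : Measure (Fin d → ℝ)) [IsFiniteMeasure P] {M : ℕ}
    (U : Fin M → Fin d → ℝ) : IsFiniteMeasure (mixMeasure P U) :=
  inferInstanceAs (IsFiniteMeasure (∑ k : Fin M, shiftLaw P (U k)))

instance isFiniteMeasure_mixMeasure1 (P : Measure ℝ) [IsFiniteMeasure P] {M : ℕ}
    (U : Fin M → ℝ) : IsFiniteMeasure (mixMeasure1 P U) :=
  inferInstanceAs (IsFiniteMeasure (∑ k : Fin M, shiftLaw1 P (U k)))

lemma withDensity_prior (P : Measure (Fin d → ℝ)) [IsFiniteMeasure P] {M : ℕ}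
    (U : Fin M → Fin d → ℝ) (k : Fin M) :
    (mixMeasure P U).withDensity (prior P U k) = shiftLaw P (U k) := by
  have hle : shiftLaw P (U k) ≤ mixMeasure P U :=
    Finset.single_le_sum (f := fun k => shiftLaw P (U k)) (fun _ _ => Measure.zero_le _)
      (Finset.mem_univ k)
  have : (shiftLaw P (U k)).HaveLebesgueDecomposition (mixMeasure P U) :=
    Measure.haveLebesgueDecomposition_of_sigmaFinite _ _
  exact Measure.withDensity_rnDeriv_eq _ _ (Measure.absolutelyContinuous_of_le hle)

lemma withDensity_prior1 (P : Measure ℝ) [IsFiniteMeasure P] {M : ℕ}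
    (U : Fin M → ℝ) (k : Fin M) :
    (mixMeasure1 P U).withDensity (prior1 P U k) = shiftLaw1 P (U k) := by
  have hle : shiftLaw1 P (U k) ≤ mixMeasure1 P U :=
    Finset.single_le_sum (f := fun k => shiftLaw1 P (U k)) (fun _ _ => Measure.zero_le _)
      (Finset.mem_univ k)
  exact Measure.withDensity_rnDeriv_eq _ _ (Measure.absolutelyContinuous_of_le hle)

lemma measurable_prior (P : Measure (Fin d → ℝ)) {M : ℕ} (U : Fin M → Fin d → ℝ)
    (k : Fin M) : Measurable (prior P U k) :=
  Measure.measurable_rnDeriv _ _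

lemma measurable_prior1 (P : Measure ℝ) {M : ℕ} (U : Fin M → ℝ) (k : Fin M) :
    Measurable (prior1 P U k) :=
  Measure.measurable_rnDeriv _ _

lemma map_eval_shiftLaw_pi (μ : Fin d → Measure ℝ) [∀ i, IsProbabilityMeasure (μ i)]
    (i : Fin d) (u : Fin d → ℝ) :
    (shiftLaw (Measure.pi μ) u).map (fun x => x i) = shiftLaw1 (μ i) (u i) := by
  rw [shiftLaw, shiftLaw1, Measure.map_map (by fun_prop) (by fun_prop)]
  have h : (Measure.pi μ).map (fun x => x i) = μ i := (measurePreserving_eval μ i).map_eq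
  conv_rhs => rw [← h]
  rw [Measure.map_map (by fun_prop) (by fun_prop)]
  rfl

lemma map_eval_mixMeasure_pi (μ : Fin d → Measure ℝ) [∀ i, IsProbabilityMeasure (μ i)]
    (i : Fin d) {M : ℕ} (U : Fin M → Fin d → ℝ) :
    (mixMeasure (Measure.pi μ) U).map (fun x => x i) =
      mixMeasure1 (μ i) (fun k => U k i) := by
  rw [mixMeasure, Measure.map_finset_sum' (measurable_pi_apply i).aemeasurable]
  simp only [map_eval_shiftLaw_pi, mixMeasure1]

/-- Averaging the priors over the conditional law given coordinate `i` yields the priors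
of the scalar test. -/
lemma lintegral_condDistrib_prior_ae_eq (μ : Fin d → Measure ℝ)
    [∀ i, IsProbabilityMeasure (μ i)] (i : Fin d) {M : ℕ} (U : Fin M → Fin d → ℝ)
    (k : Fin M) :
    (fun s => ∫⁻ x, prior (Measure.pi μ) U k x
      ∂(condDistrib id (fun x : Fin d → ℝ => x i) (mixMeasure (Measure.pi μ) U) s))
      =ᵐ[mixMeasure1 (μ i) (fun k => U k i)] prior1 (μ i) (fun k => U k i) k := by
  set ν := mixMeasure (Measure.pi μ) U with hν
  set K := condDistrib id (fun x : Fin d → ℝ => x i) ν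
  have hK : mixMeasure1 (μ i) (fun k => U k i) ⊗ₘ K = ν.map fun x => (x i, x) := by
    rw [← map_eval_mixMeasure_pi μ i U]
    exact compProd_map_condDistrib (by fun_prop)
  have hp := measurable_prior (Measure.pi μ) U k
  have hm : Measurable fun s => ∫⁻ x, prior (Measure.pi μ) U k x ∂(K s) :=
    hp.lintegral_kernel
  refine (Measure.rnDeriv_withDensity _ hm).symm.trans (Filter.EventuallyEq.of_eq ?_)
  unfold prior1
  congr 1
  ext A hA
  rw [withDensity_apply _ hA, ← map_eval_shiftLaw_pi μ i, Measure.map_apply (by fun_prop) hA,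
    ← withDensity_prior, withDensity_apply _ (hA.preimage (by fun_prop)), ← hν]
  have h := Measure.setLIntegral_compProd (μ := mixMeasure1 (μ i) (fun k => U k i)) (κ := K)
    (f := fun z => prior (Measure.pi μ) U k z.2) (by fun_prop) hA MeasurableSet.univ
  simp only [Measure.restrict_univ] at h
  rw [← h, hK, setLIntegral_map (hA.prod MeasurableSet.univ) (by fun_prop) (by fun_prop)]
  congr 2
  ext x
  simp

section ProductChannel

variable {𝒵 : Fin d → Type*} [∀ i, MeasurableSpace (𝒵 i)]

/-- Decision rules that look only at coordinate `i` bound the vector Bayes error. -/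
lemma bayesError_le_sum_eval (P : Measure (Fin d → ℝ)) (κi : ∀ i, Kernel ℝ (𝒵 i))
    [∀ i, IsMarkovKernel (κi i)] (κ : Kernel (Fin d → ℝ) (∀ i, 𝒵 i))
    (hprod : ∀ x : Fin d → ℝ, κ x = Measure.pi fun i => κi i (x i))
    {M : ℕ} (U : Fin M → Fin d → ℝ) (i : Fin d) (x : Fin d → ℝ) (φ : 𝒵 i → Fin M)
    (hφ : Measurable φ) :
    bayesError P κ U x ≤ ∑ k, prior P U k x * κi i (x i + U k i) {y | φ y ≠ k} := by
  refine (iInf₂_le (fun y => φ (y i)) (by fun_prop)).trans_eq ?_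
  refine Finset.sum_congr rfl fun k _ => ?_
  have h := (measurePreserving_eval (fun j => κi j ((x + U k) j)) i).measure_preimage
    (s := {y | φ y ≠ k}) (hφ (MeasurableSet.singleton k).compl).nullMeasurableSet
  rw [hprod]
  exact congrArg _ h

/-- The vector Bayes error integrates to at most the scalar one. -/
lemma lintegral_bayesError_pi_le (μ : Fin d → Measure ℝ) [∀ i, IsProbabilityMeasure (μ i)]
    (κi : ∀ i, Kernel ℝ (𝒵 i)) [∀ i, IsMarkovKernel (κi i)]
    (κ : Kernel (Fin d → ℝ) (∀ i, 𝒵 i))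
    (hprod : ∀ x : Fin d → ℝ, κ x = Measure.pi fun i => κi i (x i))
    {M : ℕ} (U : Fin M → Fin d → ℝ) (i : Fin d) :
    ∫⁻ x, bayesError (Measure.pi μ) κ U x ∂(mixMeasure (Measure.pi μ) U) ≤
      ∫⁻ s, bayesError1 (μ i) (κi i) (fun k => U k i) s
        ∂(mixMeasure1 (μ i) (fun k => U k i)) := by
  set ν := mixMeasure (Measure.pi μ) U
  set K := condDistrib id (fun x : Fin d → ℝ => x i) ν
  have hK : mixMeasure1 (μ i) (fun k => U k i) ⊗ₘ K = ν.map fun x => (x i, x) := by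
    rw [← map_eval_mixMeasure_pi μ i U]
    exact compProd_map_condDistrib (by fun_prop)
  obtain ⟨g, hg, hgle, hgeq⟩ := exists_measurable_le_lintegral_eq (μ := ν)
    (bayesError (Measure.pi μ) κ U)
  have hdis : ∫⁻ x, g x ∂ν =
      ∫⁻ s, ∫⁻ x, g x ∂(K s) ∂(mixMeasure1 (μ i) (fun k => U k i)) := by
    have h := Measure.lintegral_compProd (μ := mixMeasure1 (μ i) (fun k => U k i)) (κ := K)
      (f := fun z => g z.2) (by fun_prop)
    rw [← h, hK, lintegral_map (by fun_prop) (by fun_prop)]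
  have hfib : ∀ᵐ s ∂(mixMeasure1 (μ i) (fun k => U k i)), ∀ᵐ x ∂(K s), x i = s := by
    have h : ∀ᵐ z ∂(mixMeasure1 (μ i) (fun k => U k i) ⊗ₘ K), z.2 i = z.1 := by
      rw [hK, ae_map_iff (by fun_prop) (measurableSet_eq_fun (by fun_prop) (by fun_prop))]
      exact Filter.Eventually.of_forall fun x => rfl
    exact Measure.ae_ae_of_ae_compProd h
  have hprior : ∀ᵐ s ∂(mixMeasure1 (μ i) (fun k => U k i)), ∀ k,
      ∫⁻ x, prior (Measure.pi μ) U k x ∂(K s) = prior1 (μ i) (fun k => U k i) k s :=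
    ae_all_iff.2 fun k => lintegral_condDistrib_prior_ae_eq μ i U k
  rw [hgeq, hdis]
  refine lintegral_mono_ae ?_
  filter_upwards [hfib, hprior] with s hs hps
  refine le_iInf₂ fun φ hφ => ?_
  have hp := measurable_prior (Measure.pi μ) U
  calc ∫⁻ x, g x ∂(K s)
      ≤ ∫⁻ x, ∑ k, prior (Measure.pi μ) U k x * κi i (s + U k i) {y | φ y ≠ k} ∂(K s) := by
        refine lintegral_mono_ae ?_
        filter_upwards [hs] with x hx
        rw [← hx]
        exact (hgle x).trans (bayesError_le_sum_eval _ κi κ hprod U i x φ hφ)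
    _ = ∑ k, prior1 (μ i) (fun k => U k i) k s * κi i (s + U k i) {y | φ y ≠ k} := by
        rw [lintegral_finsetSum _ fun k _ => (hp k).mul_const _]
        refine Finset.sum_congr rfl fun k _ => ?_
        rw [lintegral_mul_const _ (hp k), hps k]

lemma hFun_pi_le (μ : Fin d → Measure ℝ) [∀ i, IsProbabilityMeasure (μ i)]
    (κi : ∀ i, Kernel ℝ (𝒵 i)) [∀ i, IsMarkovKernel (κi i)]
    (κ : Kernel (Fin d → ℝ) (∀ i, 𝒵 i))
    (hprod : ∀ x : Fin d → ℝ, κ x = Measure.pi fun i => κi i (x i))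
    (M : ℕ) (t : ℝ) (i : Fin d) :
    hFun (Measure.pi μ) κ M t i ≤ hFun1 (μ i) (κi i) M t :=
  iSup₂_le fun U hU => (lintegral_bayesError_pi_le μ κi κ hprod U i).trans <|
    le_iSup₂_of_le (fun k => U k i) hU le_rfl

end ProductChannel

section AxisShift

variable {n : ℕ} (i : Fin (n + 1))

lemma map_piFinSuccAbove_shiftLaw_single (μ : Fin (n + 1) → Measure ℝ)
    [∀ i, IsProbabilityMeasure (μ i)] (a : ℝ) :
    (shiftLaw (Measure.pi μ) (Pi.single i a)).map
        (MeasurableEquiv.piFinSuccAbove (fun _ => ℝ) i) =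
      (shiftLaw1 (μ i) a).prod (Measure.pi fun j => μ (i.succAbove j)) := by
  have h := (measurePreserving_piFinSuccAbove μ i).map_eq
  have hQ : (Measure.pi fun j => μ (i.succAbove j)).map id =
    Measure.pi fun j => μ (i.succAbove j) := Measure.map_id
  rw [shiftLaw, shiftLaw1, ← hQ, Measure.map_prod_map _ _ (by fun_prop) measurable_id, ← h,
    Measure.map_map (by fun_prop) (by fun_prop), Measure.map_map (by fun_prop) (by fun_prop)]
  congr 1
  funext x
  refine Prod.ext ?_ (funext fun j => ?_)
  · change x i - (Pi.single i a : Fin (n + 1) → ℝ) i = x i - a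
    rw [Pi.single_eq_same]
  · change x (i.succAbove j) - (Pi.single i a : Fin (n + 1) → ℝ) (i.succAbove j) =
      x (i.succAbove j)
    rw [Pi.single_eq_of_ne (Fin.succAbove_ne i j), sub_zero]

lemma map_piFinSuccAbove_mixMeasure_single (μ : Fin (n + 1) → Measure ℝ)
    [∀ i, IsProbabilityMeasure (μ i)] {M : ℕ} (a : Fin M → ℝ) :
    (mixMeasure (Measure.pi μ) fun k => Pi.single i (a k)).map
        (MeasurableEquiv.piFinSuccAbove (fun _ => ℝ) i) =
      (mixMeasure1 (μ i) a).prod (Measure.pi fun j => μ (i.succAbove j)) := by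
  rw [mixMeasure, Measure.map_finset_sum' (by fun_prop), mixMeasure1,
    ← Measure.sum_fintype (fun k => shiftLaw1 (μ i) (a k)), Measure.prod_sum_left,
    Measure.sum_fintype]
  simp only [map_piFinSuccAbove_shiftLaw_single]

/-- When all shifts are along axis `i`, the priors depend only on coordinate `i`. -/
lemma prior_pi_single_ae_eq (μ : Fin (n + 1) → Measure ℝ)
    [∀ i, IsProbabilityMeasure (μ i)] {M : ℕ} (a : Fin M → ℝ) (k : Fin M) :
    prior (Measure.pi μ) (fun k => Pi.single i (a k)) k
      =ᵐ[mixMeasure (Measure.pi μ) fun k => Pi.single i (a k)]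
        fun x => prior1 (μ i) a k (x i) := by
  set e := MeasurableEquiv.piFinSuccAbove (fun _ : Fin (n + 1) => ℝ) i
  have hp := measurable_prior1 (μ i) a k
  have hm : Measurable fun x : Fin (n + 1) → ℝ => prior1 (μ i) a k (x i) := by fun_prop
  refine Filter.EventuallyEq.trans (Filter.EventuallyEq.of_eq ?_)
    (Measure.rnDeriv_withDensity _ hm)
  suffices h : shiftLaw (Measure.pi μ) (Pi.single i (a k)) =
      (mixMeasure (Measure.pi μ) fun k => Pi.single i (a k)).withDensity
        fun x => prior1 (μ i) a k (x i) by rw [← h]; rfl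
  refine e.map_measurableEquiv_injective ?_
  rw [map_piFinSuccAbove_shiftLaw_single, ← withDensity_prior1, prod_withDensity_left hp,
    ← map_piFinSuccAbove_mixMeasure_single]
  ext A hA
  rw [withDensity_apply _ hA, setLIntegral_map hA (by fun_prop) e.measurable,
    Measure.map_apply e.measurable hA, withDensity_apply _ (e.measurable hA)]
  rfl

variable {𝒵 : Fin (n + 1) → Type*} [∀ i, MeasurableSpace (𝒵 i)]

/-- When hypotheses differ only in the law of coordinate `i`, the remaining coordinates of
the observation act as independent randomization and do not decrease the error. -/
lemma bayesError1_le_of_pi_single (μ : Fin (n + 1) → Measure ℝ)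
    (κi : ∀ i, Kernel ℝ (𝒵 i)) [∀ i, IsMarkovKernel (κi i)]
    (κ : Kernel (Fin (n + 1) → ℝ) (∀ i, 𝒵 i))
    (hprod : ∀ x : Fin (n + 1) → ℝ, κ x = Measure.pi fun i => κi i (x i))
    {M : ℕ} (a : Fin M → ℝ) (x : Fin (n + 1) → ℝ)
    (hx : ∀ k, prior (Measure.pi μ) (fun k => Pi.single i (a k)) k x =
      prior1 (μ i) a k (x i)) :
    bayesError1 (μ i) (κi i) a (x i) ≤
      bayesError (Measure.pi μ) κ (fun k => Pi.single i (a k)) x := by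
  refine le_iInf₂ fun φ hφ => ?_
  set e := MeasurableEquiv.piFinSuccAbove 𝒵 i
  let ρ : Measure (∀ j, 𝒵 (i.succAbove j)) :=
    Measure.pi fun j => κi (i.succAbove j) (x (i.succAbove j))
  have hψ : Measurable fun z => φ (e.symm z) := hφ.comp e.symm.measurable
  have hset : ∀ k, MeasurableSet {z | φ (e.symm z) ≠ k} := fun k =>
    hψ (MeasurableSet.singleton k).compl
  have herr : ∀ k, κ (x + Pi.single i (a k)) {y | φ y ≠ k} =
      ∫⁻ r, κi i (x i + a k) {y | φ (e.symm (y, r)) ≠ k} ∂ρ := by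
    intro k
    have h := (measurePreserving_piFinSuccAbove
      (fun j => κi j ((x + Pi.single i (a k) : Fin (n + 1) → ℝ) j)) i).measure_preimage_equiv
      {z | φ (e.symm z) ≠ k}
    simp only [Pi.add_apply, Pi.single_eq_same,
      Pi.single_eq_of_ne (Fin.succAbove_ne i _), add_zero] at h
    rw [Measure.prod_apply_symm (hset k)] at h
    rw [hprod]
    refine Eq.trans ?_ h
    congr 1
    ext y
    change φ y ≠ k ↔ φ (e.symm (e y)) ≠ k
    rw [e.symm_apply_apply]
  have hmeas : ∀ k, Measurable fun r => κi i (x i + a k) {y | φ (e.symm (y, r)) ≠ k} :=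
    fun k => measurable_measure_prodMk_right (hset k)
  calc bayesError1 (μ i) (κi i) a (x i)
      = ∫⁻ _, bayesError1 (μ i) (κi i) a (x i) ∂ρ := by simp
    _ ≤ ∫⁻ r, ∑ k, prior1 (μ i) a k (x i) *
          κi i (x i + a k) {y | φ (e.symm (y, r)) ≠ k} ∂ρ :=
        lintegral_mono fun r =>
          iInf₂_le (fun y => φ (e.symm (y, r))) (hψ.comp measurable_prodMk_right)
    _ = _ := by
        rw [lintegral_finsetSum _ fun k _ => (hmeas k).const_mul _]
        refine Finset.sum_congr rfl fun k _ => ?_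
        rw [lintegral_const_mul _ (hmeas k), hx k, herr k]

end AxisShift

lemma hFun1_le_hFun_pi {𝒵 : Fin d → Type*} [∀ i, MeasurableSpace (𝒵 i)]
    (μ : Fin d → Measure ℝ) [∀ i, IsProbabilityMeasure (μ i)]
    (κi : ∀ i, Kernel ℝ (𝒵 i)) [∀ i, IsMarkovKernel (κi i)]
    (κ : Kernel (Fin d → ℝ) (∀ i, 𝒵 i))
    (hprod : ∀ x : Fin d → ℝ, κ x = Measure.pi fun i => κi i (x i))
    (M : ℕ) (t : ℝ) (i : Fin d) :
    hFun1 (μ i) (κi i) M t ≤ hFun (Measure.pi μ) κ M t i := by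
  cases d with
  | zero => exact i.elim0
  | succ n =>
    refine iSup₂_le fun a ha => ?_
    refine le_iSup₂_of_le (fun k => Pi.single i (a k)) (fun k => by simp [ha k]) ?_
    have hmap := map_eval_mixMeasure_pi μ i fun k => Pi.single i (a k)
    simp only [Pi.single_eq_same] at hmap
    rw [← hmap]
    refine (lintegral_map_le _ _).trans (lintegral_mono_ae ?_)
    filter_upwards [ae_all_iff.2 fun k => prior_pi_single_ae_eq i μ a k] with x hx
    exact bayesError1_le_of_pi_single i μ κi κ hprod a x hx

/-- **Tensorization of the Ziv–Zakai bound (Proposition 1).**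
If `P_X` is a product measure and the channel factorizes coordinatewise, then the
Ziv–Zakai bounds (with and without valley-filling) are the sums of the scalar bounds. -/
theorem ziv_zakai_tensorization
    {d : ℕ} (hd : 1 ≤ d) {𝒴 : Fin d → Type*} [∀ i, MeasurableSpace (𝒴 i)]
    (μ : Fin d → Measure ℝ) (hμ : ∀ i, IsProbabilityMeasure (μ i))
    (κi : ∀ i, Kernel ℝ (𝒴 i)) (hκi : ∀ i, IsMarkovKernel (κi i))
    (κ : Kernel (Fin d → ℝ) (∀ i, 𝒴 i)) (hκ : IsMarkovKernel κ)
    (hprod : ∀ x : Fin d → ℝ, κ x = Measure.pi fun i => κi i (x i))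
    (M : ℕ) (hM : 2 ≤ M) :
    ZZbar (Measure.pi μ) κ M = ∑ i : Fin d, ZZbar1 (μ i) (κi i) M ∧
    ZZ (Measure.pi μ) κ M = ∑ i : Fin d, ZZ1 (μ i) (κi i) M := by
  have key : ∀ i t, hFun (Measure.pi μ) κ M t i = hFun1 (μ i) (κi i) M t := fun i t =>
    le_antisymm (hFun_pi_le μ κi κ hprod M t i) (hFun1_le_hFun_pi μ κi κ hprod M t i)
  simp only [ZZbar, ZZbar1, ZZ, ZZ1, key, and_self]
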